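/- Let D ⊂ ℂ be compact and let Γ be a closed contour winding once counterclockwise around D without intersecting it. Then for all w ∈ D^N and t > 0, K_N(t,w) = −∮_Γ (dz/2π) e^{−itz} ∏_{ℓ=1}^N (i/(z − w_ℓ)), where K_N is the simplex oscillatory integral defined by K_1(t,w)=e^{−itw} and the recursion K_{N+1}(t,w) = ∫_0^t e^{−i(t−r)w_{N+1}} K_N(r,w_1,…,w_N) dr. -/

import Mathlib

open MeasureTheory

/-- The simplex oscillatory integral `K_{N+1}(t,w)` (with `N+1` factors), equivalently
defined by `K_1(t,w)=e^{−itw}` and `K_{N+1}(t,w) = ∫_0^t e^{−i(t−r)w_{N+1}} K_N(r,w) dr`. -/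
noncomputable def simplexK (N : ℕ) (t : ℝ) (w : Fin (N + 1) → ℂ) : ℂ :=
  ∫ s in {s : Fin N → ℝ | (∀ i, 0 ≤ s i) ∧ ∑ i, s i ≤ t},
    Complex.exp (-Complex.I * ∑ ℓ : Fin N, (s ℓ : ℂ) * w ℓ.castSucc) *
      Complex.exp (-Complex.I * ((t : ℂ) - ∑ ℓ : Fin N, (s ℓ : ℂ)) * w (Fin.last N))

noncomputable def contourG (γ : ℝ → ℂ) (n : ℕ) (t : ℝ) (w : Fin n → ℂ) : ℂ :=
  ∫ s in (0 : ℝ)..1, deriv γ s *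
          (Complex.exp (-Complex.I * (t : ℂ) * γ s) *
            ∏ ℓ : Fin n, Complex.I / (γ s - w ℓ))

lemma contourG_zero (γ : ℝ → ℂ) (hγ : ContDiff ℝ 1 γ) (hclosed : γ 0 = γ 1)
    (t : ℝ) (w : Fin 0 → ℂ) : contourG γ 0 t w = 0 := by
  have hd : ∀ s, HasDerivAt γ (deriv γ s) s := fun s =>
    (hγ.differentiable (by norm_num) s).hasDerivAt
  have hc : Continuous (deriv γ) := hγ.continuous_deriv (by norm_num)
  have hc' := hγ.continuous
  unfold contourG
  simp only [Finset.univ_eq_empty, Finset.prod_empty, mul_one]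
  by_cases ht : t = 0
  · subst ht
    simp only [Complex.ofReal_zero, mul_zero, zero_mul, Complex.exp_zero, mul_one]
    rw [intervalIntegral.integral_eq_sub_of_hasDerivAt (fun s _ => hd s)
      (hc.intervalIntegrable _ _), hclosed, sub_self]
  · have htc : (t : ℂ) ≠ 0 := by exact_mod_cast ht
    rw [intervalIntegral.integral_eq_sub_of_hasDerivAt
      (f := fun s => Complex.exp (-Complex.I * (t : ℂ) * γ s) / (-Complex.I * t))
      (fun s _ => ?_) ((by fun_prop : Continuous _).intervalIntegrable _ _)]
    · simp [hclosed]
    · have := (((hd s).const_mul (-Complex.I * (t : ℂ))).cexp).div_const (-Complex.I * t)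
      refine this.congr_deriv ?_
      have := Complex.I_ne_zero
      field_simp

lemma inner_int (t : ℝ) (a z : ℂ) (h : z - a ≠ 0) :
    ∫ s in (0 : ℝ)..t, Complex.exp (-Complex.I * s * a) *
      Complex.exp (-Complex.I * ((t - s : ℝ) : ℂ) * z) =
    (Complex.exp (-Complex.I * t * z) - Complex.exp (-Complex.I * t * a)) *
      (Complex.I / (z - a)) := by
  have hI := Complex.I_ne_zero
  rw [intervalIntegral.integral_eq_sub_of_hasDerivAt
      (f := fun s : ℝ => Complex.exp (-Complex.I * s * a + -Complex.I * ((t : ℂ) - s) * z) /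
        (Complex.I * (z - a)))
      (fun s _ => ?_) ((by fun_prop : Continuous _).intervalIntegrable _ _)]
  · simp only [sub_self, Complex.ofReal_zero, mul_zero, zero_mul, add_zero, sub_zero, zero_add]
    field_simp
    rw [Complex.I_sq]
    ring
  · have h1 : HasDerivAt (fun s : ℝ => (s : ℂ)) 1 s := Complex.ofRealCLM.hasDerivAt
    have h2 := ((((h1.const_mul (-Complex.I)).mul_const a).add
      (((h1.const_sub (t : ℂ)).const_mul (-Complex.I)).mul_const z)).cexp).div_const
        (Complex.I * (z - a))
    refine h2.congr_deriv ?_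
    rw [← Complex.exp_add]
    push_cast
    simp only [Pi.add_apply]
    field_simp
    ring

lemma contourG_rec (γ : ℝ → ℂ) (hγ : ContDiff ℝ 1 γ) (n : ℕ)
    (t : ℝ) (w : Fin (n + 1) → ℂ) (hw : ∀ ℓ, ∀ s ∈ Set.Icc (0 : ℝ) 1, γ s ≠ w ℓ) :
    ∫ s in (0 : ℝ)..t, Complex.exp (-Complex.I * s * w 0) *
      contourG γ n (t - s) (fun ℓ => w ℓ.succ) =
    contourG γ (n + 1) t w - Complex.exp (-Complex.I * t * w 0) * contourG γ (n + 1) 0 w := by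
  have hc : Continuous (deriv γ) := hγ.continuous_deriv (by norm_num)
  have hc' := hγ.continuous
  have hne : ∀ ℓ, ∀ s ∈ Set.uIcc (0 : ℝ) 1, γ s - w ℓ ≠ 0 := by
    intro ℓ s hs
    rw [Set.uIcc_of_le zero_le_one] at hs
    exact sub_ne_zero.2 (hw ℓ s hs)
  unfold contourG
  simp_rw [← intervalIntegral.integral_const_mul]
  rw [intervalIntegral_intervalIntegral_swap, ← intervalIntegral.integral_sub]
  · apply intervalIntegral.integral_congr
    intro u hu
    simp only
    have : ∀ s : ℝ, Complex.exp (-Complex.I * s * w 0) * (deriv γ u *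
        (Complex.exp (-Complex.I * ((t - s : ℝ) : ℂ) * γ u) *
          ∏ ℓ : Fin n, Complex.I / (γ u - w ℓ.succ))) =
        (deriv γ u * ∏ ℓ : Fin n, Complex.I / (γ u - w ℓ.succ)) *
        (Complex.exp (-Complex.I * s * w 0) *
          Complex.exp (-Complex.I * ((t - s : ℝ) : ℂ) * γ u)) := fun s => by ring
    simp_rw [this]
    rw [intervalIntegral.integral_const_mul, inner_int _ _ _ (hne 0 u hu), Fin.prod_univ_succ]
    simp
    ring
  · apply ContinuousOn.intervalIntegrable
    refine hc.continuousOn.mul ((by fun_prop : Continuous _).continuousOn.mul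
      (continuousOn_finsetProd _ fun ℓ _ => continuousOn_const.div
        (by fun_prop) (hne ℓ)))
  · apply ContinuousOn.intervalIntegrable
    refine continuousOn_const.mul (hc.continuousOn.mul ((by fun_prop : Continuous _).continuousOn.mul
      (continuousOn_finsetProd _ fun ℓ _ => continuousOn_const.div
        (by fun_prop) (hne ℓ))))
  · refine IntegrableOn.mono_set (t := Set.uIcc 0 t ×ˢ Set.uIcc 0 1) ?_
      (Set.prod_mono Set.uIoc_subset_uIcc Set.uIoc_subset_uIcc)
    apply ContinuousOn.integrableOn_compact (isCompact_uIcc.prod isCompact_uIcc)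
    refine ContinuousOn.mul (by fun_prop) (ContinuousOn.mul (by fun_prop) (ContinuousOn.mul
      (by fun_prop) (continuousOn_finsetProd _ fun ℓ _ => continuousOn_const.div
        (by fun_prop) (fun p hp => hne _ _ hp.2))))

lemma rat_zero {ι : Type*} [DecidableEq ι] (γ : ℝ → ℂ) (hγ : ContDiff ℝ 1 γ)
    (hclosed : γ 0 = γ 1) (w : ι → ℂ) (hw : ∀ ℓ, ∀ s ∈ Set.Icc (0 : ℝ) 1, γ s ≠ w ℓ)
    (c : ℂ) (hc : ∀ ℓ, (∫ s in (0 : ℝ)..1, deriv γ s / (γ s - w ℓ)) = c) :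
    ∀ (n : ℕ) (S : Finset ι), S.card = n → 2 ≤ n →
      ∫ s in (0 : ℝ)..1, deriv γ s * ∏ ℓ ∈ S, (γ s - w ℓ)⁻¹ = 0 := by
  have hd : ∀ s, HasDerivAt γ (deriv γ s) s := fun s =>
    (hγ.differentiable (by norm_num) s).hasDerivAt
  have hcd : Continuous (deriv γ) := hγ.continuous_deriv (by norm_num)
  have hc' := hγ.continuous
  have hne : ∀ ℓ, ∀ s ∈ Set.uIcc (0 : ℝ) 1, γ s - w ℓ ≠ 0 := by
    intro ℓ s hs
    rw [Set.uIcc_of_le zero_le_one] at hs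
    exact sub_ne_zero.2 (hw ℓ s hs)
  have hint : ∀ S : Finset ι, IntervalIntegrable
      (fun s => deriv γ s * ∏ ℓ ∈ S, (γ s - w ℓ)⁻¹) volume 0 1 := fun S =>
    ContinuousOn.intervalIntegrable (hcd.continuousOn.mul
      (continuousOn_finsetProd _ fun ℓ _ => ContinuousOn.inv₀ (by fun_prop) (hne ℓ)))
  intro n
  induction n using Nat.strong_induction_on with
  | _ n ih =>
  intro S hS hn
  by_cases hex : ∃ a ∈ S, ∃ b ∈ S, w a ≠ w b
  · obtain ⟨a, ha, b, hb, hab⟩ := hex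
    have hab' : a ≠ b := fun h => hab (h ▸ rfl)
    have hsub : w a - w b ≠ 0 := sub_ne_zero.2 hab
    have e : ∫ s in (0 : ℝ)..1, deriv γ s * ∏ ℓ ∈ S, (γ s - w ℓ)⁻¹ =
        ∫ s in (0 : ℝ)..1, (w a - w b)⁻¹ * ((deriv γ s * ∏ ℓ ∈ S.erase b, (γ s - w ℓ)⁻¹) -
          deriv γ s * ∏ ℓ ∈ S.erase a, (γ s - w ℓ)⁻¹) := by
      apply intervalIntegral.integral_congr
      intro s hs
      have h1 := hne a s hs
      have h2 := hne b s hs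
      simp only
      rw [← Finset.mul_prod_erase S _ ha,
        ← Finset.mul_prod_erase (S.erase a) _ (Finset.mem_erase.2 ⟨hab'.symm, hb⟩),
        ← Finset.mul_prod_erase (S.erase b) _ (Finset.mem_erase.2 ⟨hab', ha⟩),
        Finset.erase_right_comm]
      field_simp
      ring
    rw [e, intervalIntegral.integral_const_mul, intervalIntegral.integral_sub (hint _) (hint _)]
    have hca : (S.erase a).card = n - 1 := by rw [Finset.card_erase_of_mem ha, hS]
    have hcb : (S.erase b).card = n - 1 := by rw [Finset.card_erase_of_mem hb, hS]
    by_cases h2 : n = 2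
    · subst h2
      obtain ⟨x, hx⟩ := Finset.card_eq_one.1 hca
      obtain ⟨y, hy⟩ := Finset.card_eq_one.1 hcb
      rw [hx, hy]
      simp only [Finset.prod_singleton, ← div_eq_mul_inv, hc, sub_self, mul_zero]
    · rw [ih (n - 1) (by omega) _ hca (by omega), ih (n - 1) (by omega) _ hcb (by omega)]
      simp
  · push Not at hex
    obtain ⟨a, ha⟩ : S.Nonempty := Finset.card_pos.1 (by omega)
    obtain ⟨m, rfl⟩ : ∃ m, n = m + 2 := ⟨n - 2, by omega⟩
    have hp : ∀ s, ∏ ℓ ∈ S, (γ s - w ℓ)⁻¹ = ((γ s - w a)⁻¹) ^ (m + 2) := by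
      intro s
      rw [← hS]
      exact Finset.prod_eq_pow_card (fun ℓ hℓ => by rw [hex ℓ hℓ a ha])
    have hi := hint S
    simp_rw [hp] at hi ⊢
    have hm : (m : ℂ) + 1 ≠ 0 := by exact_mod_cast Nat.succ_ne_zero m
    rw [intervalIntegral.integral_eq_sub_of_hasDerivAt
      (f := fun s => - ((γ s - w a)⁻¹) ^ (m + 1) / (m + 1)) (fun s hs => ?_) hi]
    · simp [hclosed]
    · have h1 := hne a s hs
      have := (((((hd s).sub_const (w a)).inv h1).pow (m + 1)).neg).div_const ((m : ℂ) + 1)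
      refine this.congr_deriv ?_
      push_cast
      simp only [Pi.inv_apply, inv_pow]
      field_simp
      ring

lemma simplexK_zero (t : ℝ) (ht : 0 ≤ t) (w : Fin 1 → ℂ) :
    simplexK 0 t w = Complex.exp (-Complex.I * t * w 0) := by
  unfold simplexK
  have : {s : Fin 0 → ℝ | (∀ i, 0 ≤ s i) ∧ ∑ i, s i ≤ t} = Set.univ := by
    ext s; simp [ht]
  rw [this]
  simp [integral_unique, Measure.real, volume_pi]

def simplexS (N : ℕ) (t : ℝ) : Set (Fin N → ℝ) := {s | (∀ i, 0 ≤ s i) ∧ ∑ i, s i ≤ t}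

noncomputable def simplexF (N : ℕ) (t : ℝ) (w : Fin (N + 1) → ℂ) (s : Fin N → ℝ) : ℂ :=
    Complex.exp (-Complex.I * ∑ ℓ : Fin N, (s ℓ : ℂ) * w ℓ.castSucc) *
      Complex.exp (-Complex.I * ((t : ℂ) - ∑ ℓ : Fin N, (s ℓ : ℂ)) * w (Fin.last N))

lemma simplexS_closed (N : ℕ) (t : ℝ) : IsClosed (simplexS N t) := by
  have : simplexS N t = (⋂ i, {s | 0 ≤ s i}) ∩ {s | ∑ i, s i ≤ t} := by
    ext s; simp [simplexS]
  rw [this]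
  refine (isClosed_iInter fun i => isClosed_le (by fun_prop) (by fun_prop)).inter
    (isClosed_le (by fun_prop) (by fun_prop))

lemma simplexS_compact (N : ℕ) (t : ℝ) : IsCompact (simplexS N t) := by
  refine (isCompact_Icc (a := (0 : Fin N → ℝ)) (b := fun _ => t)).of_isClosed_subset
    (simplexS_closed N t) ?_
  rintro s ⟨h1, h2⟩
  exact ⟨h1, fun i => (Finset.single_le_sum (fun j _ => h1 j) (Finset.mem_univ i)).trans h2⟩

lemma simplexF_cont (N : ℕ) (t : ℝ) (w : Fin (N + 1) → ℂ) : Continuous (simplexF N t w) := by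
  unfold simplexF
  fun_prop

lemma simplexK_eq (N : ℕ) (t : ℝ) (w : Fin (N + 1) → ℂ) :
    simplexK N t w = ∫ s, (simplexS N t).indicator (simplexF N t w) s := by
  rw [integral_indicator (simplexS_closed N t).measurableSet]
  rfl

lemma simplexK_succ (N : ℕ) (t : ℝ) (ht : 0 ≤ t) (w : Fin (N + 2) → ℂ) :
    simplexK (N + 1) t w = ∫ s in (0 : ℝ)..t, Complex.exp (-Complex.I * s * w 0) *
      simplexK N (t - s) (fun ℓ => w ℓ.succ) := by
  rw [simplexK_eq]
  have hint : Integrable ((simplexS (N + 1) t).indicator (simplexF (N + 1) t w)) :=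
    (integrable_indicator_iff (simplexS_closed _ t).measurableSet).2
      ((simplexF_cont _ t w).continuousOn.integrableOn_compact (simplexS_compact _ t))
  have mp := (volume_preserving_piFinSuccAbove (fun _ : Fin (N + 1) => ℝ) 0).symm
  rw [← mp.integral_comp (MeasurableEquiv.measurableEmbedding _)]
  have hint2 := (mp.integrable_comp_emb (MeasurableEquiv.measurableEmbedding _)).2 hint
  rw [Measure.volume_eq_prod] at hint2 ⊢
  refine (integral_prod _ hint2).trans ?_
  simp only [Function.comp_apply]
  rw [intervalIntegral.integral_of_le ht, ← integral_Icc_eq_integral_Ioc,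
    ← integral_indicator measurableSet_Icc]
  congr 1
  ext x
  by_cases hx : x ∈ Set.Icc 0 t
  · rw [Set.indicator_of_mem hx, simplexK_eq, ← integral_const_mul]
    congr 1
    ext y
    have hmem : (MeasurableEquiv.piFinSuccAbove (fun _ : Fin (N + 1) => ℝ) 0).symm (x, y) ∈
        simplexS (N + 1) t ↔ y ∈ simplexS N (t - x) := by
      simp [simplexS, MeasurableEquiv.piFinSuccAbove, Fin.forall_fin_succ, Fin.sum_univ_succ,
        hx.1, le_sub_iff_add_le']
    by_cases hy : y ∈ simplexS N (t - x)
    · rw [Set.indicator_of_mem (hmem.2 hy), Set.indicator_of_mem hy]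
      simp only [simplexF, ← Complex.exp_add]
      congr 1
      simp [MeasurableEquiv.piFinSuccAbove, Fin.sum_univ_succ]
      ring
    · rw [Set.indicator_of_notMem (fun h => hy (hmem.1 h)), Set.indicator_of_notMem hy, mul_zero]
  · rw [Set.indicator_of_notMem hx]
    refine integral_eq_zero_of_ae (Filter.Eventually.of_forall fun y => ?_)
    apply Set.indicator_of_notMem
    intro h
    apply hx
    have h1 := h.1
    have h2 := h.2
    simp [MeasurableEquiv.piFinSuccAbove, Fin.forall_fin_succ, Fin.sum_univ_succ] at h1 h2
    exact ⟨h1.1, by linarith [Finset.sum_nonneg (fun i (_ : i ∈ Finset.univ) => h1.2 i)]⟩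

/-- Contour representation: if `Γ` (parameterized by a `C¹` closed curve `γ` on `[0,1]`)
winds once counterclockwise around the compact set `D` without intersecting it, then for
all `w ∈ D^{N+1}` and `t > 0`,
`K_{N+1}(t,w) = −∮_Γ (dz/2π) e^{−itz} ∏_ℓ i/(z − w_ℓ)`. -/
theorem stmt_8 (N : ℕ) (D : Set ℂ) (hD : IsCompact D) (γ : ℝ → ℂ)
    (hγ : ContDiff ℝ 1 γ) (hclosed : γ 0 = γ 1)
    (hdisj : ∀ s ∈ Set.Icc (0 : ℝ) 1, γ s ∉ D)
    (hwind : ∀ z ∈ D, (∫ s in (0 : ℝ)..1, deriv γ s / (γ s - z)) =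
      2 * (Real.pi : ℂ) * Complex.I)
    (t : ℝ) (ht : 0 < t) (w : Fin (N + 1) → ℂ) (hw : ∀ ℓ, w ℓ ∈ D) :
    simplexK N t w =
      -((∫ s in (0 : ℝ)..1, deriv γ s *
          (Complex.exp (-Complex.I * (t : ℂ) * γ s) *
            ∏ ℓ : Fin (N + 1), Complex.I / (γ s - w ℓ))) / (2 * (Real.pi : ℂ))) := by
  have key : ∀ (N : ℕ) (t : ℝ), 0 ≤ t → ∀ w : Fin (N + 1) → ℂ, (∀ ℓ, w ℓ ∈ D) →
      contourG γ (N + 1) t w = -(2 * (Real.pi : ℂ)) * simplexK N t w := by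
    intro N
    induction N with
    | zero =>
      intro t ht w hw
      have h := contourG_rec γ hγ 0 t w (fun ℓ s hs h => hdisj s hs (h ▸ hw ℓ))
      have h0 : contourG γ 1 0 w = -(2 * (Real.pi : ℂ)) := by
        have := hwind (w 0) (hw 0)
        have e : contourG γ 1 0 w = Complex.I * ∫ s in (0 : ℝ)..1, deriv γ s / (γ s - w 0) := by
          rw [← intervalIntegral.integral_const_mul]
          unfold contourG
          congr 1
          ext s
          simp
          ring
        rw [e, this]
        linear_combination (2 * (Real.pi : ℂ)) * Complex.I_mul_I
      rw [h0] at h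
      simp only [contourG_zero γ hγ hclosed, mul_zero, intervalIntegral.integral_zero] at h
      rw [simplexK_zero t ht]
      linear_combination -h
    | succ N ih =>
      intro t ht w hw
      have h := contourG_rec γ hγ (N + 1) t w (fun ℓ s hs h => hdisj s hs (h ▸ hw ℓ))
      have h0 : contourG γ (N + 2) 0 w = 0 := by
        have := rat_zero γ hγ hclosed w (fun ℓ s hs h => hdisj s hs (h ▸ hw ℓ)) _
          (fun ℓ => hwind _ (hw ℓ)) _ Finset.univ rfl (by simp)
        have e : contourG γ (N + 2) 0 w =
            Complex.I ^ (N + 2) * ∫ s in (0 : ℝ)..1, deriv γ s * ∏ ℓ, (γ s - w ℓ)⁻¹ := by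
          rw [← intervalIntegral.integral_const_mul]
          unfold contourG
          congr 1
          ext s
          simp only [div_eq_mul_inv, Finset.prod_mul_distrib]
          simp
          ring
        rw [e, this, mul_zero]
      rw [h0, mul_zero, sub_zero] at h
      rw [← h, simplexK_succ N t ht w, ← intervalIntegral.integral_const_mul]
      apply intervalIntegral.integral_congr
      intro s hs
      rw [Set.uIcc_of_le ht] at hs
      simp only
      rw [ih (t - s) (by linarith [hs.2]) _ (fun ℓ => hw _)]
      ring
  have h := key N t ht.le w hw
  unfold contourG at h
  rw [h]
  have : (Real.pi : ℂ) ≠ 0 := by exact_mod_cast Real.pi_ne_zero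
  field_simp
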